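/- For all weights x, y > 0, the weighted connective constant of self-avoiding trails on the square lattice satisfies μ^T(x,y) ≤ 2^{−1/3}·[x³ + 12xy(x + y) + y³ + (x² + 5xy + y²)·√(x² + 14xy + y²)]^{1/3}. -/

import Mathlib

open scoped BigOperators

def sqStep : Fin 4 → ℤ × ℤ
  | 0 => (1, 0)
  | 1 => (-1, 0)
  | 2 => (0, 1)
  | 3 => (0, -1)

/-- Position of the walk after `i` steps, starting at the origin. -/
def sqPos {n : ℕ} (ω : Fin n → Fin 4) (i : Fin (n + 1)) : ℤ × ℤ :=
  ∑ j : Fin n, if (j : ℕ) < (i : ℕ) then sqStep (ω j) else 0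

/-- A walk is a self-avoiding trail if its undirected edges are pairwise distinct. -/
def sqIsSAT {n : ℕ} (ω : Fin n → Fin 4) : Prop :=
  Function.Injective (fun i : Fin n => s(sqPos ω i.castSucc, sqPos ω i.succ))

/-- Number of horizontal steps. -/
def sqNh {n : ℕ} (ω : Fin n → Fin 4) : ℕ :=
  (Finset.univ.filter fun j => ω j = 0 ∨ ω j = 1).card

/-- Number of vertical steps. -/
def sqNv {n : ℕ} (ω : Fin n → Fin 4) : ℕ :=
  (Finset.univ.filter fun j => ω j = 2 ∨ ω j = 3).card

/-- Weight `x^{N_h} y^{N_v}` of a walk. -/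
noncomputable def sqWeight (x y : ℝ) {n : ℕ} (ω : Fin n → Fin 4) : ℝ :=
  x ^ sqNh ω * y ^ sqNv ω

/- `satCount n x y` is `c^T_n(x,y)`: the sum of the weights of all `n`-step
self-avoiding trails starting at the origin. -/
open Classical in
noncomputable def satCount (n : ℕ) (x y : ℝ) : ℝ :=
  ∑ ω ∈ Finset.univ.filter (fun ω : Fin n → Fin 4 => sqIsSAT ω), sqWeight x y ω

/-- The weighted connective constant `μ^T(x,y) = inf_{n ≥ 1} c^T_n(x,y)^{1/n}`. -/
noncomputable def satMu (x y : ℝ) : ℝ :=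
  ⨅ n : ℕ, satCount (n + 1) x y ^ (1 / (n + 1 : ℝ))

/-- The weight of a single step: `x` if horizontal, `y` if vertical. -/
def sqStepWeight (x y : ℝ) (d : Fin 4) : ℝ := if d = 0 ∨ d = 1 then x else y

/-- The step opposite to a given one. -/
def sqRev : Fin 4 → Fin 4
  | 0 => 1
  | 1 => 0
  | 2 => 3
  | 3 => 2

/-- A walk is non-backtracking if no step is opposite to its predecessor. -/
def sqNonBacktracking {n : ℕ} (ω : Fin (n + 1) → Fin 4) : Prop :=
  ∀ i : Fin n, ω i.castSucc ≠ sqRev (ω i.succ)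

theorem sqStep_sqRev (d : Fin 4) : sqStep (sqRev d) = -sqStep d := by
  fin_cases d <;> rfl

theorem sqPos_succ {n : ℕ} (ω : Fin n → Fin 4) (i : Fin n) :
    sqPos ω i.succ = sqPos ω i.castSucc + sqStep (ω i) := by
  have h : sqStep (ω i) = ∑ j : Fin n, if j = i then sqStep (ω j) else 0 := by simp
  rw [h]
  unfold sqPos
  rw [← Finset.sum_add_distrib]
  refine Finset.sum_congr rfl fun j _ => ?_
  rcases lt_trichotomy (j : ℕ) (i : ℕ) with hj | hj | hj
  · have : j ≠ i := fun e => by simp [e] at hj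
    simp [hj, this, Nat.lt_succ_of_lt hj]
  · simp [Fin.ext hj]
  · have : j ≠ i := fun e => by simp [e] at hj
    have h2 : ¬ (j : ℕ) < i + 1 := by omega
    simp [this, not_lt.2 hj.le, h2]

theorem sqIsSAT.sqNonBacktracking {n : ℕ} {ω : Fin (n + 1) → Fin 4} (h : sqIsSAT ω) :
    sqNonBacktracking ω := by
  intro i hi
  have key : i.castSucc = i.succ := by
    apply h
    have h1 := sqPos_succ ω i.castSucc
    have h2 := sqPos_succ ω i.succ
    rw [hi, sqStep_sqRev, Fin.succ_castSucc] at h1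
    have h3 : sqPos ω i.succ.succ = sqPos ω i.castSucc.castSucc := by
      rw [h2, h1]; abel
    simp only [h3, Fin.succ_castSucc]
    exact Sym2.eq_swap
  exact Fin.castSucc_lt_succ.ne key

theorem sqWeight_eq_prod (x y : ℝ) {n : ℕ} (ω : Fin n → Fin 4) :
    sqWeight x y ω = ∏ i, sqStepWeight x y (ω i) := by
  have h : ∀ d : Fin 4, ¬ (d = 0 ∨ d = 1) ↔ d = 2 ∨ d = 3 := by decide
  simp only [sqStepWeight, Finset.prod_ite, Finset.prod_const, sqWeight, sqNh, sqNv, h]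

theorem sqStepWeight_pos {x y : ℝ} (hx : 0 < x) (hy : 0 < y) (d : Fin 4) :
    0 < sqStepWeight x y d := by
  unfold sqStepWeight; split_ifs <;> assumption

theorem sqNonBacktracking_cons {n : ℕ} (d : Fin 4) (ω : Fin (n + 1) → Fin 4) :
    sqNonBacktracking (Fin.cons d ω : Fin (n + 2) → Fin 4) ↔
      d ≠ sqRev (ω 0) ∧ sqNonBacktracking ω := by
  simp [sqNonBacktracking, Fin.forall_fin_succ (n := n)]

open Classical in
/-- If `f` is an eigenvector of the non-backtracking transfer operator with eigenvalue `l`, then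
prepending a step multiplies the `f`-weighted sum over non-backtracking walks by `l`. -/
theorem sum_sqNonBacktracking {x y l : ℝ} {f : Fin 4 → ℝ}
    (hf : ∀ e, ∑ d, (if d ≠ sqRev e then sqStepWeight x y d * f d else 0) = l * f e) (n : ℕ) :
    ∑ ω : Fin (n + 1) → Fin 4, (if sqNonBacktracking ω then sqWeight x y ω * f (ω 0) else 0) =
      l ^ n * ∑ d, sqStepWeight x y d * f d := by
  induction n with
  | zero =>
    rw [← (Equiv.funUnique (Fin 1) (Fin 4)).symm.sum_comp]
    simp [sqNonBacktracking, sqWeight_eq_prod]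
  | succ n ih =>
    rw [← (Fin.consEquiv fun _ => Fin 4).sum_comp, Fintype.sum_prod_type_right, pow_succ',
      mul_assoc, ← ih, Finset.mul_sum]
    refine Finset.sum_congr rfl fun ω _ => ?_
    change ∑ d, (if sqNonBacktracking (Fin.cons d ω : Fin (n + 2) → Fin 4) then
      sqWeight x y (Fin.cons d ω : Fin (n + 2) → Fin 4) * f d else 0) = _
    simp only [sqNonBacktracking_cons, sqWeight_eq_prod,
      Fin.prod_univ_succ (n := n + 1), Fin.cons_zero, Fin.cons_succ]
    by_cases h : sqNonBacktracking ω
    · simp only [h, and_true, if_true]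
      rw [mul_left_comm, ← hf (ω 0), Finset.mul_sum]
      refine Finset.sum_congr rfl fun d _ => ?_
      split_ifs <;> ring
    · simp [h]

theorem satCount_nonneg {x y : ℝ} (hx : 0 < x) (hy : 0 < y) (n : ℕ) : 0 ≤ satCount n x y :=
  Finset.sum_nonneg fun _ _ => mul_nonneg (pow_nonneg hx.le _) (pow_nonneg hy.le _)

theorem satCount_succ_le {x y l c : ℝ} (hx : 0 < x) (hy : 0 < y) {f : Fin 4 → ℝ} (hc : 0 < c)
    (hcf : ∀ d, c ≤ f d)
    (hf : ∀ e, ∑ d, (if d ≠ sqRev e then sqStepWeight x y d * f d else 0) = l * f e) (n : ℕ) :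
    satCount (n + 1) x y ≤ l ^ n * ((∑ d, sqStepWeight x y d * f d) / c) := by
  classical
  rw [← mul_div_assoc, le_div_iff₀ hc, ← sum_sqNonBacktracking hf, satCount, Finset.sum_filter,
    Finset.sum_mul]
  refine Finset.sum_le_sum fun ω _ => ?_
  have hw : 0 ≤ sqWeight x y ω := mul_nonneg (pow_nonneg hx.le _) (pow_nonneg hy.le _)
  by_cases h : sqIsSAT ω
  · simp only [h, h.sqNonBacktracking, if_true]
    exact mul_le_mul_of_nonneg_left (hcf _) hw
  · simp only [h, if_false, zero_mul]
    split_ifs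
    · exact mul_nonneg hw (hc.le.trans (hcf _))
    · exact le_rfl

theorem satMu_le_of_satCount_succ_le {x y l C : ℝ} (hx : 0 < x) (hy : 0 < y) (hl : 0 < l)
    (hC : 0 < C) (h : ∀ n, satCount (n + 1) x y ≤ l ^ (n + 1) * C) : satMu x y ≤ l := by
  have hlim : Filter.Tendsto (fun n : ℕ => l * C ^ (1 / (n + 1 : ℝ))) Filter.atTop (nhds l) := by
    have h0 := tendsto_one_div_add_atTop_nhds_zero_nat (𝕜 := ℝ)
    have := ((Real.continuous_const_rpow hC.ne').tendsto 0).comp h0 |>.const_mul l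
    simpa [Function.comp_def] using this
  refine ge_of_tendsto' hlim fun n => ?_
  have hbdd : BddBelow (Set.range fun n : ℕ => satCount (n + 1) x y ^ (1 / (n + 1 : ℝ))) :=
    ⟨0, by rintro _ ⟨k, rfl⟩; exact Real.rpow_nonneg (satCount_nonneg hx hy _) _⟩
  refine (ciInf_le hbdd n).trans ?_
  calc satCount (n + 1) x y ^ (1 / (n + 1 : ℝ))
      ≤ (l ^ (n + 1) * C) ^ (1 / (n + 1 : ℝ)) :=
        Real.rpow_le_rpow (satCount_nonneg hx hy _) (h n) (by positivity)
    _ = l * C ^ (1 / (n + 1 : ℝ)) := by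
        rw [Real.mul_rpow (by positivity) hC.le]
        congr 1
        have := Real.pow_rpow_inv_natCast hl.le n.succ_ne_zero
        simpa using this

/-- The connective constant is at most the Perron eigenvalue of the non-backtracking transfer
matrix, whose characteristic equation is `(l - x) * (l - y) = 4 * x * y`. -/
theorem satMu_le_of_eigenvalue {x y l : ℝ} (hx : 0 < x) (hy : 0 < y) (hxl : x < l)
    (hl : (l - x) * (l - y) = 4 * x * y) : satMu x y ≤ l := by
  have hl0 : 0 < l := hx.trans hxl
  set f : Fin 4 → ℝ := fun d => if d = 0 ∨ d = 1 then 2 * y else l - x with hfdef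
  have hpos : ∀ d, 0 < f d := fun d => by
    simp only [hfdef]; split_ifs <;> linarith
  have hf : ∀ e, ∑ d, (if d ≠ sqRev e then sqStepWeight x y d * f d else 0) = l * f e := by
    intro e
    fin_cases e <;> simp [Fin.sum_univ_four, sqRev, sqStepWeight, hfdef] <;> linarith
  have hc : ∀ d, min (2 * y) (l - x) ≤ f d := fun d => by
    simp only [hfdef]; split_ifs <;> simp
  have hc0 : 0 < min (2 * y) (l - x) := lt_min (by linarith) (by linarith)
  set S := ∑ d, sqStepWeight x y d * f d with hS
  have hS0 : 0 < S :=
    Finset.sum_pos (fun d _ => mul_pos (sqStepWeight_pos hx hy d) (hpos d)) Finset.univ_nonempty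
  refine satMu_le_of_satCount_succ_le (C := S / min (2 * y) (l - x) / l) hx hy hl0
    (by positivity) fun n => ?_
  refine (satCount_succ_le hx hy hc0 hc hf n).trans_eq ?_
  rw [← hS, pow_succ]
  field_simp

theorem satMu_le_bound_m1_n4 (x y : ℝ) (hx : 0 < x) (hy : 0 < y) :
    satMu x y ≤ (2 : ℝ) ^ (-(1 / 3 : ℝ)) *
      (x ^ 3 + 12 * x * y * (x + y) + y ^ 3 +
        (x ^ 2 + 5 * x * y + y ^ 2) *
          Real.sqrt (x ^ 2 + 14 * x * y + y ^ 2)) ^ (1 / 3 : ℝ) := by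
  set s := Real.sqrt (x ^ 2 + 14 * x * y + y ^ 2) with hs
  have hss : s ^ 2 = x ^ 2 + 14 * x * y + y ^ 2 := Real.sq_sqrt (by positivity)
  have hxy : 0 < x * y := mul_pos hx hy
  have hxs : x < s := Real.lt_sqrt_of_sq_lt (by nlinarith [sq_nonneg y])
  have hlt : x < (x + y + s) / 2 := by
    have : x - y < s := by linarith
    linarith
  have hl0 : 0 < (x + y + s) / 2 := hx.trans hlt
  refine (satMu_le_of_eigenvalue hx hy hlt (by nlinarith)).trans_eq ?_
  have hcube : x ^ 3 + 12 * x * y * (x + y) + y ^ 3 + (x ^ 2 + 5 * x * y + y ^ 2) * s =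
      2 * ((x + y + s) / 2) ^ 3 := by
    linear_combination (-(3 * (x + y) + s) / 4) * hss
  rw [hcube, Real.mul_rpow (by norm_num) (by positivity), ← mul_assoc,
    ← Real.rpow_add (by norm_num)]
  have := Real.pow_rpow_inv_natCast hl0.le (n := 3) (by norm_num)
  simp only [neg_add_cancel, Real.rpow_zero, one_mul, one_div]
  exact_mod_cast this.symm
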